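/- Let μ be a non-atomic, σ-finite measure with μ(T) > 0, and let φ be a deformed exponential. Then there exists a measurable function u₀ : T → (0,∞) satisfying condition (C) for φ if, and only if, limsup_{u→∞} φ(u)/φ(u − λ₀) < ∞ for some λ₀ > 0. -/

import Mathlib

open MeasureTheory Filter Set
open scoped ENNReal NNReal

lemma aux_mono (φ : ℝ → ℝ) (hconv : ConvexOn ℝ Set.univ φ) (hnonneg : ∀ u, 0 ≤ φ u)
    (hbot : Tendsto φ atBot (nhds 0)) : Monotone φ := by
  intro x y hxy
  by_contra! h
  have h1 : ∀ᶠ z in atBot, φ x ≤ φ z := by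
    filter_upwards [eventually_le_atBot x] with z hz
    have := hconv.le_max_of_mem_Icc (mem_univ z) (mem_univ y) ⟨hz, hxy⟩
    rcases le_max_iff.1 this with h2 | h2
    · exact h2
    · linarith
  have := ge_of_tendsto hbot h1
  linarith [hnonneg y]

lemma aux_small {T : Type*} [MeasurableSpace T] (μ : Measure T)
    (hna : ∀ A : Set T, MeasurableSet A → 0 < μ A →
      ∃ B ⊆ A, MeasurableSet B ∧ 0 < μ B ∧ μ B < μ A)
    (A : Set T) (hA : MeasurableSet A) (hpos : 0 < μ A) (hfin : μ A < ⊤)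
    (ε : ℝ≥0∞) (hε : 0 < ε) : ∃ B ⊆ A, MeasurableSet B ∧ 0 < μ B ∧ μ B ≤ ε := by
  have key : ∀ n : ℕ, ∃ B ⊆ A, MeasurableSet B ∧ 0 < μ B ∧ μ B ≤ (2⁻¹ : ℝ≥0∞) ^ n * μ A := by
    intro n
    induction n with
    | zero => exact ⟨A, le_rfl, hA, hpos, by simp⟩
    | succ n ih =>
      obtain ⟨B, hBA, hB, hB0, hBn⟩ := ih
      obtain ⟨C, hCB, hC, hC0, hClt⟩ := hna B hB hB0
      have hBfin : μ B ≠ ⊤ := ((measure_mono hBA).trans_lt hfin).ne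
      have hCfin : μ C ≠ ⊤ := hClt.ne_top
      have hsum : μ C + μ (B \ C) = μ B := by
        rw [measure_diff hCB hC.nullMeasurableSet hCfin]
        exact add_tsub_cancel_of_le hClt.le
      have hhalf : ∀ x : ℝ≥0∞, x ≤ 2⁻¹ * μ B → x ≤ (2⁻¹ : ℝ≥0∞) ^ (n+1) * μ A := by
        intro x hx
        refine hx.trans ?_
        rw [pow_succ', mul_assoc]
        gcongr
      rcases le_or_gt (μ C) (2⁻¹ * μ B) with h | h
      · exact ⟨C, hCB.trans hBA, hC, hC0, hhalf _ h⟩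
      · refine ⟨B \ C, diff_subset.trans hBA, hB.diff hC, ?_, hhalf _ ?_⟩
        · rw [measure_diff hCB hC.nullMeasurableSet hCfin]
          exact tsub_pos_of_lt hClt
        · by_contra! h2
          have := ENNReal.add_lt_add h h2
          rw [hsum, ← add_mul, ENNReal.inv_two_add_inv_two, one_mul] at this
          exact lt_irrefl _ this
  have ht : Tendsto (fun n : ℕ => (2⁻¹ : ℝ≥0∞) ^ n * μ A) atTop (nhds (0 * μ A)) := by
    refine ENNReal.Tendsto.mul_const (ENNReal.tendsto_pow_atTop_nhds_zero_of_lt_one ?_) (Or.inr hfin.ne)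
    exact ENNReal.inv_lt_one.2 (by norm_num)
  rw [zero_mul] at ht
  obtain ⟨n, hn⟩ := (ht.eventually (gt_mem_nhds hε)).exists
  obtain ⟨B, h1, h2, h3, h4⟩ := key n
  exact ⟨B, h1, h2, h3, h4.trans hn.le⟩

lemma aux_sier {T : Type*} [MeasurableSpace T] (μ : Measure T)
    (hna : ∀ A : Set T, MeasurableSet A → 0 < μ A →
      ∃ B ⊆ A, MeasurableSet B ∧ 0 < μ B ∧ μ B < μ A)
    (A : Set T) (hA : MeasurableSet A) (hfin : μ A < ⊤)
    (ε : ℝ≥0∞) (hε : 0 < ε) (hεA : ε ≤ μ A) :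
    ∃ B ⊆ A, MeasurableSet B ∧ ε / 2 ≤ μ B ∧ μ B ≤ ε := by
  by_contra! hcon
  have hεt : ε ≠ ⊤ := (hεA.trans_lt hfin).ne
  have hlt : ∀ B ⊆ A, MeasurableSet B → μ B ≤ ε → μ B < ε / 2 := by
    intro B h1 h2 h3
    by_contra! h4
    exact absurd h3 (not_le.2 (hcon B h1 h2 h4))
  let S : Set ℝ≥0∞ := {x | ∃ B ⊆ A, MeasurableSet B ∧ μ B ≤ ε ∧ μ B = x}
  have hS : S.Nonempty := ⟨0, ∅, by simp, by simp, by simp, by simp⟩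
  obtain ⟨x, -, hx, hxS⟩ := exists_seq_tendsto_sSup hS (OrderTop.bddAbove S)
  choose B hBA hB hBε hBx using hxS
  have hacc : ∀ n, μ (accumulate B n) ≤ ε ∧ MeasurableSet (accumulate B n) ∧ accumulate B n ⊆ A := by
    intro n
    have hm : ∀ n, MeasurableSet (accumulate B n) := fun n =>
      MeasurableSet.biUnion (to_countable _) fun k _ => hB k
    have hs : ∀ n, accumulate B n ⊆ A := by
      intro n t ht
      obtain ⟨k, -, hk⟩ := mem_accumulate.1 ht
      exact hBA k hk
    refine ⟨?_, hm n, hs n⟩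
    induction n with
    | zero => simpa [accumulate_zero_nat] using hBε 0
    | succ n ih =>
      rw [accumulate_succ]
      refine (measure_union_le _ _).trans ?_
      calc _ ≤ ε / 2 + ε / 2 := add_le_add (hlt _ (hs n) (hm n) ih).le (hlt _ (hBA _) (hB _) (hBε _)).le
        _ = ε := ENNReal.add_halves ε
  let C := ⋃ n, B n
  have hCA : C ⊆ A := iUnion_subset hBA
  have hC : MeasurableSet C := MeasurableSet.iUnion hB
  have hCε : μ C ≤ ε := by
    have : Tendsto (fun n => μ (accumulate B n)) atTop (nhds (μ C)) := tendsto_measure_iUnion_accumulate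
    exact le_of_tendsto' this (fun n => (hacc n).1)
  have hC2 := hlt C hCA hC hCε
  have hsup : sSup S ≤ μ C := le_of_tendsto' hx (fun n => by
    rw [← hBx n]; exact measure_mono (subset_iUnion B n))
  have hCfin : μ C ≠ ⊤ := hC2.ne_top
  have hd : 0 < μ (A \ C) := by
    rw [measure_diff hCA hC.nullMeasurableSet hCfin]
    exact tsub_pos_of_lt (hC2.trans_le (ENNReal.half_le_self.trans hεA))
  obtain ⟨D, hDA, hD, hD0, hDε⟩ := aux_small μ hna (A \ C) (hA.diff hC) hd
    ((measure_mono diff_subset).trans_lt hfin) ε hε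
  have hD2 := hlt D (hDA.trans diff_subset) hD hDε
  have hu : μ (C ∪ D) = μ C + μ D := measure_union
    (disjoint_of_subset_right hDA disjoint_sdiff_right) hD
  have hmem : μ (C ∪ D) ∈ S := ⟨C ∪ D, union_subset hCA (hDA.trans diff_subset), hC.union hD, by
    rw [hu, ← ENNReal.add_halves ε]; exact add_le_add hC2.le hD2.le, rfl⟩
  have h1 := (le_sSup hmem).trans hsup
  rw [hu] at h1
  exact absurd h1 (not_le.2 (ENNReal.lt_add_right hCfin hD0.ne'))

lemma aux_disj {T : Type*} [MeasurableSpace T] (μ : Measure T)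
    (hna : ∀ A : Set T, MeasurableSet A → 0 < μ A →
      ∃ B ⊆ A, MeasurableSet B ∧ 0 < μ B ∧ μ B < μ A)
    (A : Set T) (hA : MeasurableSet A) (hpos : 0 < μ A) (hfin : μ A < ⊤) :
    ∃ P : ℕ → Set T, (∀ n, P n ⊆ A) ∧ (∀ n, MeasurableSet (P n)) ∧ (∀ n, 0 < μ (P n)) ∧
      Pairwise (Function.onFun Disjoint P) := by
  choose! f hfs hfm hf0 hflt using hna
  let Q : ℕ → Set T := fun n => f^[n] A
  have hQs : ∀ n, Q (n+1) = f (Q n) := fun n => Function.iterate_succ_apply' f n A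
  have hQ : ∀ n, MeasurableSet (Q n) ∧ 0 < μ (Q n) ∧ Q n ⊆ A := by
    intro n
    induction n with
    | zero => exact ⟨hA, hpos, le_rfl⟩
    | succ n ih =>
      rw [hQs]
      exact ⟨hfm _ ih.1 ih.2.1, hf0 _ ih.1 ih.2.1, (hfs _ ih.1 ih.2.1).trans ih.2.2⟩
  have hsub : ∀ n, Q (n+1) ⊆ Q n := fun n => by rw [hQs]; exact hfs _ (hQ n).1 (hQ n).2.1
  have hanti : Antitone Q := antitone_nat_of_succ_le hsub
  refine ⟨fun n => Q n \ Q (n+1), fun n => diff_subset.trans (hQ n).2.2,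
    fun n => (hQ n).1.diff (hQ _).1, fun n => ?_, ?_⟩
  · have hl : μ (Q (n+1)) < μ (Q n) := by rw [hQs]; exact hflt _ (hQ n).1 (hQ n).2.1
    rw [measure_diff (hsub n) (hQ _).1.nullMeasurableSet hl.ne_top]
    exact tsub_pos_of_lt hl
  · refine (pairwise_disjoint_on _).2 fun m n hmn => ?_
    refine disjoint_left.2 fun t h1 h2 => h1.2 (hanti (Nat.succ_le_of_lt hmn) h2.1)

lemma aux_c0 {T : Type*} [MeasurableSpace T] (μ : Measure T) [SigmaFinite μ]
    (φ : ℝ → ℝ) (hbot : Tendsto φ atBot (nhds 0)) :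
    ∃ c : T → ℝ, Measurable c ∧ ∫⁻ t, ENNReal.ofReal (φ (c t)) ∂μ < ⊤ := by
  classical
  obtain ⟨g, hg0, hgm, hg⟩ := exists_pos_lintegral_lt_of_sigmaFinite μ (ε := 1) (by simp)
  have hex : ∀ t, ∃ n : ℕ, φ (-(n:ℝ)) ≤ g t := by
    intro t
    have h1 : Tendsto (fun n : ℕ => φ (-(n:ℝ))) atTop (nhds 0) :=
      hbot.comp (tendsto_neg_atTop_atBot.comp tendsto_natCast_atTop_atTop)
    exact (h1.eventually (ge_mem_nhds (show (0:ℝ) < g t from hg0 t))).exists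
  have hmeas : Measurable fun t => Nat.find (hex t) := measurable_find hex (fun k =>
    measurableSet_le measurable_const hgm.coe_nnreal_real)
  refine ⟨fun t => -((Nat.find (hex t) : ℕ) : ℝ), ?_, ?_⟩
  · exact ((measurable_from_top (f := fun n : ℕ => (n:ℝ))).comp hmeas).neg
  · refine lt_of_le_of_lt (lintegral_mono fun t => ?_) (hg.trans ENNReal.one_lt_top)
    rw [← ENNReal.ofReal_coe_nnreal]
    exact ENNReal.ofReal_le_ofReal (Nat.find_spec (hex t))

lemma aux_bwd {T : Type*} [MeasurableSpace T] (μ : Measure T) [SigmaFinite μ]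
    (φ : ℝ → ℝ) (hconv : ConvexOn ℝ Set.univ φ) (hnonneg : ∀ u, 0 ≤ φ u)
    (hmono : Monotone φ) (htop : Tendsto φ atTop atTop)
    (l : ℝ) (hl : 0 < l)
    (hlim : Filter.limsup (fun u : ℝ => ENNReal.ofReal (φ u / φ (u - l))) atTop < ⊤) :
    ∃ u₀ : T → ℝ, Measurable u₀ ∧ (∀ t, 0 < u₀ t) ∧
      ∀ c : T → ℝ, Measurable c →
        (∫⁻ t, ENNReal.ofReal (φ (c t)) ∂μ < ⊤) →
        ∀ lam : ℝ, 0 < lam →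
          ∫⁻ t, ENNReal.ofReal (φ (c t + lam * u₀ t)) ∂μ < ⊤ := by
  obtain ⟨M, hM, hMt⟩ := exists_between hlim
  have hev := eventually_lt_of_limsup_lt hM
  have hev2 : ∀ᶠ u in atTop, 0 < φ (u - l) :=
    (htop.comp (tendsto_atTop_add_const_right atTop (-l) tendsto_id)).eventually (eventually_gt_atTop 0)
  obtain ⟨a, ha⟩ := eventually_atTop.1 (hev.and hev2)
  have hM0 : 0 ≤ M.toReal := ENNReal.toReal_nonneg
  have hstep : ∀ u, a ≤ u → φ (u + l) ≤ M.toReal * φ u := by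
    intro u hu
    obtain ⟨h1, h2⟩ := ha (u + l) (by linarith)
    rw [add_sub_cancel_right] at h1 h2
    have := (ENNReal.ofReal_lt_iff_lt_toReal (div_nonneg (hnonneg _) (hnonneg _)) hMt.ne).1 h1
    exact ((div_lt_iff₀ h2).1 this).le
  have hiter : ∀ n : ℕ, ∀ u, a ≤ u → φ (u + n * l) ≤ M.toReal ^ n * φ u := by
    intro n
    induction n with
    | zero => intro u _; simp
    | succ n ih =>
      intro u hu
      have h1 := hstep (u + n * l) (by have : 0 ≤ (n:ℝ) * l := by positivity
                                       linarith)
      have h2 := mul_le_mul_of_nonneg_left (ih u hu) hM0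
      have e : u + ((n+1 : ℕ):ℝ) * l = u + n * l + l := by push_cast; ring
      rw [e, pow_succ']
      linarith
  obtain ⟨g, hg0, hgm, hg⟩ := exists_pos_lintegral_lt_of_sigmaFinite μ (ε := 1) (by simp)
  refine ⟨fun t => min (g t : ℝ) 1, hgm.coe_nnreal_real.min measurable_const,
    fun t => lt_min (hg0 t) one_pos, ?_⟩
  intro c hc hci lam hlam
  obtain ⟨n, hn⟩ := exists_nat_ge (lam / l)
  have hn : lam ≤ n * l := (div_le_iff₀ hl).1 hn
  set K := 1 + M.toReal ^ n
  have hK : 0 ≤ K := by positivity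
  have hpt : ∀ t, φ (c t + lam * min (g t : ℝ) 1) ≤ K * φ (c t) + φ (a + lam) * g t := by
    intro t
    set θ := min (g t : ℝ) 1
    have hθ0 : 0 ≤ θ := le_min (g t).2 zero_le_one
    have hθ1 : θ ≤ 1 := min_le_right _ _
    have hθg : θ ≤ g t := min_le_left _ _
    have h1 := hconv.2 (mem_univ (c t)) (mem_univ (c t + lam)) (sub_nonneg.2 hθ1) hθ0 (by ring)
    simp only [smul_eq_mul] at h1
    have e : (1 - θ) * c t + θ * (c t + lam) = c t + lam * θ := by ring
    rw [e] at h1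
    have h0 := hnonneg (c t)
    have hMn : 0 ≤ M.toReal ^ n := by positivity
    rcases le_total a (c t) with h | h
    · have h2 : φ (c t + lam) ≤ M.toReal ^ n * φ (c t) := (hmono (by linarith)).trans (hiter n _ h)
      have h3 : θ * φ (c t + lam) ≤ φ (c t + lam) := mul_le_of_le_one_left (hnonneg _) hθ1
      have h4 : 0 ≤ φ (a + lam) * g t := mul_nonneg (hnonneg _) (g t).2
      have h5 : 0 ≤ θ * φ (c t) := by positivity
      simp only [K]
      linarith
    · have h2 : θ * φ (c t + lam) ≤ g t * φ (a + lam) :=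
        mul_le_mul hθg (hmono (by linarith)) (hnonneg _) (g t).2
      have h5 : 0 ≤ θ * φ (c t) := by positivity
      have h6 : 0 ≤ M.toReal ^ n * φ (c t) := by positivity
      simp only [K]
      linarith
  have hgoal : ∫⁻ t, (ENNReal.ofReal K * ENNReal.ofReal (φ (c t)) + ENNReal.ofReal (φ (a + lam)) * g t) ∂μ < ⊤ := by
    have hm : Measurable fun t => ENNReal.ofReal (φ (c t)) := (hmono.measurable.comp hc).ennreal_ofReal
    rw [lintegral_add_left (hm.const_mul _), lintegral_const_mul _ hm,
      lintegral_const_mul _ hgm.coe_nnreal_ennreal]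
    exact ENNReal.add_lt_top.2 ⟨ENNReal.mul_lt_top ENNReal.ofReal_lt_top hci,
      ENNReal.mul_lt_top ENNReal.ofReal_lt_top (hg.trans ENNReal.one_lt_top)⟩
  refine lt_of_le_of_lt (lintegral_mono fun t => ?_) hgoal
  rw [← ENNReal.ofReal_mul hK, ← ENNReal.ofReal_coe_nnreal, ← ENNReal.ofReal_mul (hnonneg _),
    ← ENNReal.ofReal_add (mul_nonneg hK (hnonneg _)) (mul_nonneg (hnonneg _) (NNReal.coe_nonneg (g t)))]
  exact ENNReal.ofReal_le_ofReal (hpt t)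

lemma aux_fwd {T : Type*} [MeasurableSpace T] (μ : Measure T) [SigmaFinite μ]
    (hμpos : 0 < μ Set.univ)
    (hna : ∀ A : Set T, MeasurableSet A → 0 < μ A →
      ∃ B ⊆ A, MeasurableSet B ∧ 0 < μ B ∧ μ B < μ A)
    (φ : ℝ → ℝ) (hmono : Monotone φ)
    (hbot : Tendsto φ atBot (nhds 0)) (htop : Tendsto φ atTop atTop)
    (u₀ : T → ℝ) (hu : Measurable u₀) (hu0 : ∀ t, 0 < u₀ t)
    (H : ∀ c : T → ℝ, Measurable c →
        (∫⁻ t, ENNReal.ofReal (φ (c t)) ∂μ < ⊤) →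
        ∀ lam : ℝ, 0 < lam →
          ∫⁻ t, ENNReal.ofReal (φ (c t + lam * u₀ t)) ∂μ < ⊤) :
      Filter.limsup (fun u : ℝ => ENNReal.ofReal (φ u / φ (u - 1))) atTop < ⊤ := by
  by_contra hlim
  have hlim : Filter.limsup (fun u : ℝ => ENNReal.ofReal (φ u / φ (u - 1))) atTop = ⊤ :=
    not_lt_top_iff.1 hlim
  -- the set A
  obtain ⟨k, hk⟩ : ∃ k : ℕ, 0 < μ {t | 1 ≤ ((k:ℝ)+1) * u₀ t} := by
    by_contra! h
    have : μ (⋃ k : ℕ, {t | 1 ≤ ((k:ℝ)+1) * u₀ t}) = 0 :=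
      measure_iUnion_null fun k => le_antisymm (h k) (zero_le)
    have e : (⋃ k : ℕ, {t | 1 ≤ ((k:ℝ)+1) * u₀ t}) = univ := by
      refine eq_univ_of_forall fun t => mem_iUnion.2 ?_
      obtain ⟨k, hk⟩ := exists_nat_ge (1 / u₀ t)
      refine ⟨k, ?_⟩
      have := (div_le_iff₀ (hu0 t)).1 hk
      have := hu0 t
      simp only [mem_setOf_eq]
      linarith
    rw [e] at this
    exact hμpos.ne' this
  have hkm : MeasurableSet {t | 1 ≤ ((k:ℝ)+1) * u₀ t} :=
    measurableSet_le measurable_const (hu.const_mul _)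
  obtain ⟨A, hA, hAk, hA0, hAt⟩ := Measure.exists_subset_measure_lt_top hkm hk
  obtain ⟨P, hPA, hPm, hP0, hPd⟩ := aux_disj μ hna A hA hA0 hAt
  have hPt : ∀ n, μ (P n) < ⊤ := fun n => (measure_mono (hPA n)).trans_lt hAt
  have hsel : ∀ n : ℕ, ∃ u : ℝ, 0 < ENNReal.ofReal (φ (u - 1)) ∧
      2⁻¹ ^ n / ENNReal.ofReal (φ (u - 1)) ≤ μ (P n) ∧
      2 * n * 2 ^ n * ENNReal.ofReal (φ (u - 1)) ≤ ENNReal.ofReal (φ u) := by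
    intro n
    have h1 : Tendsto (fun u : ℝ => φ (u - 1)) atTop atTop :=
      htop.comp (tendsto_atTop_add_const_right atTop (-1) tendsto_id)
    have hf : ∃ᶠ u in atTop, (2 * n * 2 ^ n : ℝ≥0∞) < ENNReal.ofReal (φ u / φ (u - 1)) := by
      refine frequently_lt_of_lt_limsup (by isBoundedDefault) ?_
      rw [hlim]
      have : (2 * n * 2 ^ n : ℝ≥0∞) = ((2 * n * 2 ^ n : ℕ) : ℝ≥0∞) := by push_cast; rfl
      rw [this]
      exact ENNReal.natCast_lt_top _
    obtain ⟨u, h2, h3, h4⟩ := (hf.and_eventually ((h1.eventually (eventually_gt_atTop 0)).and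
      (h1.eventually (eventually_ge_atTop ((2⁻¹ ^ n / μ (P n)).toReal))))).exists
    have hne : ENNReal.ofReal (φ (u - 1)) ≠ 0 := (ENNReal.ofReal_pos.2 h3).ne'
    refine ⟨u, ENNReal.ofReal_pos.2 h3, ?_, ?_⟩
    · have h5 : 2⁻¹ ^ n / μ (P n) ≤ ENNReal.ofReal (φ (u - 1)) := by
        refine (ENNReal.le_ofReal_iff_toReal_le ?_ h3.le).2 h4
        exact ENNReal.div_ne_top (ENNReal.pow_ne_top (by simp)) (hP0 n).ne'
      rw [ENNReal.div_le_iff hne ENNReal.ofReal_ne_top]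
      rw [ENNReal.div_le_iff (hP0 n).ne' (hPt n).ne] at h5
      rwa [mul_comm]
    · rw [ENNReal.ofReal_div_of_pos h3] at h2
      exact (ENNReal.le_div_iff_mul_le (Or.inl hne) (Or.inl ENNReal.ofReal_ne_top)).1 h2.le
  choose u hF0 hFP hFu using hsel
  have hFt : ∀ n, ENNReal.ofReal (φ (u n - 1)) ≠ ⊤ := fun n => ENNReal.ofReal_ne_top
  have hB : ∀ n, ∃ B ⊆ P n, MeasurableSet B ∧
      2⁻¹ ^ n / ENNReal.ofReal (φ (u n - 1)) / 2 ≤ μ B ∧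
      μ B ≤ 2⁻¹ ^ n / ENNReal.ofReal (φ (u n - 1)) := fun n =>
    aux_sier μ hna (P n) (hPm n) (hPt n) _
      (ENNReal.div_pos (pow_ne_zero _ (by simp)) (hFt n)) (hFP n)
  choose B hBP hBm hBl hBu using hB
  have hBd : Pairwise (Function.onFun Disjoint B) := fun i j hij =>
    (hPd hij).mono (hBP i) (hBP j)
  obtain ⟨f, hf, hfB⟩ := exists_measurable_piecewise B hBm (fun n (_ : T) => u n - 1)
    (fun n => measurable_const) (fun i j hij t ht =>
      absurd ht.2 (disjoint_left.1 (hBd hij) ht.1))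
  obtain ⟨c₀, hc₀, hc₀i⟩ := aux_c0 μ φ hbot
  classical
  let U := ⋃ n, B n
  have hU : MeasurableSet U := MeasurableSet.iUnion hBm
  let c : T → ℝ := U.piecewise f c₀
  have hc : Measurable c := hf.piecewise hU hc₀
  have hcB : ∀ n, ∀ t ∈ B n, c t = u n - 1 := by
    intro n t ht
    have : c t = f t := piecewise_eq_of_mem _ _ _ (mem_iUnion.2 ⟨n, ht⟩)
    rw [this]; exact hfB n ht
  have hci : ∫⁻ t, ENNReal.ofReal (φ (c t)) ∂μ < ⊤ := by
    rw [← lintegral_add_compl _ hU]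
    refine ENNReal.add_lt_top.2 ⟨?_, ?_⟩
    · refine lt_of_le_of_lt (lintegral_iUnion_le _ _) ?_
      have hle : ∀ n, ∫⁻ t in B n, ENNReal.ofReal (φ (c t)) ∂μ ≤ 2⁻¹ ^ n := by
        intro n
        rw [setLIntegral_congr_fun (hBm n) (g := fun _ => ENNReal.ofReal (φ (u n - 1)))
          (fun t ht => by simp only [hcB n t ht]), setLIntegral_const]
        calc _ ≤ ENNReal.ofReal (φ (u n - 1)) * (2⁻¹ ^ n / ENNReal.ofReal (φ (u n - 1))) := by
              gcongr; exact hBu n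
          _ = _ := ENNReal.mul_div_cancel (hF0 n).ne' (hFt n)
      refine lt_of_le_of_lt (ENNReal.tsum_le_tsum hle) ?_
      rw [ENNReal.tsum_geometric, ENNReal.one_sub_inv_two, inv_inv]
      exact ENNReal.ofNat_lt_top
    · rw [setLIntegral_congr_fun hU.compl (g := fun t => ENNReal.ofReal (φ (c₀ t)))
        (fun t ht => by simp only [c, piecewise_eq_of_notMem _ _ _ ht])]
      exact (setLIntegral_le_lintegral _ _).trans_lt hc₀i
  have hfinal := H c hc hci ((k:ℝ)+1) (by positivity)
  have hge : ∀ n : ℕ, (n : ℝ≥0∞) ≤ ∫⁻ t, ENNReal.ofReal (φ (c t + ((k:ℝ)+1) * u₀ t)) ∂μ := by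
    intro n
    refine le_trans ?_ (setLIntegral_le_lintegral (B n) _)
    have h1 : ∫⁻ t in B n, ENNReal.ofReal (φ (u n)) ∂μ ≤
        ∫⁻ t in B n, ENNReal.ofReal (φ (c t + ((k:ℝ)+1) * u₀ t)) ∂μ := by
      refine setLIntegral_mono' (hBm n) fun t ht => ENNReal.ofReal_le_ofReal (hmono ?_)
      have : 1 ≤ ((k:ℝ)+1) * u₀ t := hAk (hPA n (hBP n ht))
      rw [hcB n t ht]; linarith
    refine le_trans ?_ h1
    rw [setLIntegral_const]
    calc (n : ℝ≥0∞) = (2 * n * 2 ^ n * ENNReal.ofReal (φ (u n - 1))) *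
          (2⁻¹ ^ n / ENNReal.ofReal (φ (u n - 1)) / 2) := by
            have e1 : (2:ℝ≥0∞) ^ n * 2⁻¹ ^ n = 1 := by
              rw [← mul_pow, ENNReal.mul_inv_cancel (by simp) (by simp), one_pow]
            have e2 := ENNReal.mul_inv_cancel (hF0 n).ne' (hFt n)
            have e3 : (2:ℝ≥0∞) * 2⁻¹ = 1 := ENNReal.mul_inv_cancel (by simp) (by simp)
            rw [div_eq_mul_inv, div_eq_mul_inv]
            calc (n : ℝ≥0∞) = n * 1 * 1 * 1 := by simp
              _ = _ := by
                nth_rewrite 1 [← e1]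
                nth_rewrite 1 [← e2]
                rw [← e3]
                ring
      _ ≤ _ := mul_le_mul' (hFu n) (hBl n)
  obtain ⟨n, hn⟩ := ENNReal.exists_nat_gt hfinal.ne
  exact absurd (hge n) (not_le.2 hn)

/-- For a non-atomic σ-finite measure `μ` with `μ(T) > 0` and a deformed
exponential `φ`, there exists a measurable `u₀ : T → (0,∞)` satisfying condition (C)
iff `limsup_{u→∞} φ(u)/φ(u − λ₀) < ∞` for some `λ₀ > 0`. -/
theorem exists_u0_iff_limsup_lt_top
    {T : Type*} [MeasurableSpace T] (μ : Measure T) [SigmaFinite μ]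
    (hμpos : 0 < μ Set.univ)
    (hna : ∀ A : Set T, MeasurableSet A → 0 < μ A →
      ∃ B ⊆ A, MeasurableSet B ∧ 0 < μ B ∧ μ B < μ A)
    (φ : ℝ → ℝ) (hconv : ConvexOn ℝ Set.univ φ) (hnonneg : ∀ u, 0 ≤ φ u)
    (hbot : Tendsto φ atBot (nhds 0)) (htop : Tendsto φ atTop atTop) :
    (∃ u₀ : T → ℝ, Measurable u₀ ∧ (∀ t, 0 < u₀ t) ∧
      ∀ c : T → ℝ, Measurable c →
        (∫⁻ t, ENNReal.ofReal (φ (c t)) ∂μ < ⊤) →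
        ∀ lam : ℝ, 0 < lam →
          ∫⁻ t, ENNReal.ofReal (φ (c t + lam * u₀ t)) ∂μ < ⊤) ↔
    (∃ lam₀ : ℝ, 0 < lam₀ ∧
      Filter.limsup (fun u : ℝ => ENNReal.ofReal (φ u / φ (u - lam₀))) atTop < ⊤) := by
  have hmono := aux_mono φ hconv hnonneg hbot
  constructor
  · rintro ⟨u₀, hu, hu0, H⟩
    exact ⟨1, one_pos, aux_fwd μ hμpos hna φ hmono hbot htop u₀ hu hu0 H⟩
  · rintro ⟨l, hl, hlim⟩
    exact aux_bwd μ φ hconv hnonneg hmono htop l hl hlim
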